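/- arXiv:2306.10725 — 2 statements merged into one kernel-verified Lean document; each statement's English description precedes it below -/
import Mathlib

section
/- There exists a unique group homomorphism φ from B to the Heisenberg group H_g such that φ(σ_i) = (1,0) for all i = 1,…,n−1, φ(α_r) = (0,a_r) and φ(β_s) = (0,b_s) for all r,s = 1,…,g; moreover φ is surjective. -/
/-- An alternating bilinear (ℤ-valued) form on a ℤ-module `M`. -/
structure SF (M : Type*) [AddCommGroup M] where
  /-- the form -/
  ω : M → M → ℤ
  addl : ∀ x y z, ω (x + y) z = ω x z + ω y z
  addr : ∀ x y z, ω x (y + z) = ω x y + ω x z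
  alt : ∀ x, ω x x = 0

/-- The Heisenberg group of `(M, ω)`: pairs (k,x) ∈ ℤ × M with multiplication
(k,x)(l,y) = (k + l + ω(x,y), x + y). -/
@[ext] structure Heis {M : Type*} [AddCommGroup M] (s : SF M) : Type _ where
  /-- the central (ℤ) component -/
  k : ℤ
  /-- the M component -/
  x : M

namespace Heis

variable {M : Type*} [AddCommGroup M] {s : SF M}

lemma omega_zero_left (s : SF M) (y : M) : s.ω 0 y = 0 := by
  have h := s.addl 0 0 y; simp only [add_zero] at h; omega

lemma omega_zero_right (s : SF M) (y : M) : s.ω y 0 = 0 := by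
  have h := s.addr y 0 0; simp only [add_zero] at h; omega

lemma omega_neg_left (s : SF M) (x y : M) : s.ω (-x) y = -s.ω x y := by
  have h := s.addl x (-x) y; simp only [add_neg_cancel, omega_zero_left] at h; omega

instance instGroup (s : SF M) : Group (Heis s) where
  mul a b := ⟨a.k + b.k + s.ω a.x b.x, a.x + b.x⟩
  one := ⟨0, 0⟩
  inv a := ⟨-a.k, -a.x⟩
  mul_assoc a b c := by
    show Heis.mk (a.k + b.k + s.ω a.x b.x + c.k + s.ω (a.x + b.x) c.x) (a.x + b.x + c.x) =
      Heis.mk (a.k + (b.k + c.k + s.ω b.x c.x) + s.ω a.x (b.x + c.x)) (a.x + (b.x + c.x))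
    rw [Heis.mk.injEq]
    refine ⟨?_, add_assoc _ _ _⟩
    rw [s.addl, s.addr]; ring
  one_mul a := by
    show Heis.mk (0 + a.k + s.ω 0 a.x) (0 + a.x) = a
    rw [omega_zero_left, zero_add, add_zero, zero_add]
  mul_one a := by
    show Heis.mk (a.k + 0 + s.ω a.x 0) (a.x + 0) = a
    rw [omega_zero_right, add_zero, add_zero, add_zero]
  inv_mul_cancel a := by
    show Heis.mk (-a.k + a.k + s.ω (-a.x) a.x) (-a.x + a.x) = Heis.mk 0 0
    rw [Heis.mk.injEq]
    refine ⟨?_, neg_add_cancel _⟩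
    rw [omega_neg_left]
    have := s.alt a.x
    omega

lemma mul_def (a b : Heis s) : a * b = ⟨a.k + b.k + s.ω a.x b.x, a.x + b.x⟩ := rfl

lemma one_def : (1 : Heis s) = ⟨0, 0⟩ := rfl

lemma inv_def (a : Heis s) : a⁻¹ = ⟨-a.k, -a.x⟩ := rfl

end Heis

/-- The standard symplectic form on ℤ^{2g} = (Fin g → ℤ) × (Fin g → ℤ), with
ω(a_r,b_s) = δ_{rs} and ω(a_r,a_s) = ω(b_r,b_s) = 0 on the standard basis. -/
def stdSF (g : ℕ) : SF ((Fin g → ℤ) × (Fin g → ℤ)) where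
  ω x y := (∑ i, x.1 i * y.2 i) - ∑ i, x.2 i * y.1 i
  addl x y z := by simp [add_mul, Finset.sum_add_distrib]; ring
  addr x y z := by simp [mul_add, Finset.sum_add_distrib]; ring
  alt x := by simp [mul_comm]
/-- Generators of the surface braid group B_n(Σ_{g,1}): braid generators σ_i
(i = 1,…,n−1) and surface generators α_r, β_s (r,s = 1,…,g). -/
inductive Gen (g n : ℕ) : Type where
  | sig : Fin (n - 1) → Gen g n
  | a : Fin g → Gen g n
  | b : Fin g → Gen g n

/-- The braid generators as elements of the free group. -/
def gsig {g n : ℕ} (i : Fin (n - 1)) : FreeGroup (Gen g n) := FreeGroup.of (Gen.sig i)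

/-- The surface generators α_r (inl r) and β_s (inr s) as elements of the free group. -/
def gab {g n : ℕ} : Fin g ⊕ Fin g → FreeGroup (Gen g n)
  | .inl r => FreeGroup.of (Gen.a r)
  | .inr s => FreeGroup.of (Gen.b s)

/-- The relators of the presentation of the surface braid group B_n(Σ_{g,1}). -/
inductive IsRel (g n : ℕ) [NeZero (n - 1)] : FreeGroup (Gen g n) → Prop where
  /-- (i) σ_iσ_j = σ_jσ_i for |i−j| ≥ 2 -/
  | comm_far (i j : Fin (n - 1)) (h : 2 ≤ ((i : ℤ) - (j : ℤ)).natAbs) :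
      IsRel g n (gsig i * gsig j * (gsig i)⁻¹ * (gsig j)⁻¹)
  /-- (ii) σ_iσ_jσ_i = σ_jσ_iσ_j for |i−j| = 1 -/
  | braid (i j : Fin (n - 1)) (h : ((i : ℤ) - (j : ℤ)).natAbs = 1) :
      IsRel g n (gsig i * gsig j * gsig i * (gsig j * gsig i * gsig j)⁻¹)
  /-- (iii) ζσ_i = σ_iζ for i > 1 and ζ among the α_r, β_s -/
  | comm_sig (i : Fin (n - 1)) (h : 0 < (i : ℕ)) (z : Fin g ⊕ Fin g) :
      IsRel g n (gab z * gsig i * (gab z)⁻¹ * (gsig i)⁻¹)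
  /-- (iv) ζ(σ_1ζσ_1) = (σ_1ζσ_1)ζ -/
  | comm_conj1 (z : Fin g ⊕ Fin g) :
      IsRel g n (gab z * (gsig 0 * gab z * gsig 0) * (gab z)⁻¹ * (gsig 0 * gab z * gsig 0)⁻¹)
  /-- (v) ζ(σ_1⁻¹ησ_1) = (σ_1⁻¹ησ_1)ζ for ζ ≠ η with {ζ,η} ≠ {α_r,β_r} -/
  | comm_conj2 (z w : Fin g ⊕ Fin g) (hne : z ≠ w)
      (hpair : ∀ r : Fin g, ¬(z = .inl r ∧ w = .inr r) ∧ ¬(z = .inr r ∧ w = .inl r)) :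
      IsRel g n (gab z * ((gsig 0)⁻¹ * gab w * gsig 0) * (gab z)⁻¹ *
        ((gsig 0)⁻¹ * gab w * gsig 0)⁻¹)
  /-- (vi) σ_1β_rσ_1α_rσ_1 = α_rσ_1β_r -/
  | special (r : Fin g) :
      IsRel g n (gsig 0 * gab (.inr r) * gsig 0 * gab (.inl r) * gsig 0 *
        (gab (.inl r) * gsig 0 * gab (.inr r))⁻¹)

/-- The surface braid group B_n(Σ_{g,1}), via its presentation. -/
def SurfaceBraidGroup (g n : ℕ) [NeZero (n - 1)] : Type :=
  PresentedGroup {x : FreeGroup (Gen g n) | IsRel g n x}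

instance (g n : ℕ) [NeZero (n - 1)] : Group (SurfaceBraidGroup g n) :=
  inferInstanceAs (Group (PresentedGroup _))

/-- The images of the generators in the surface braid group. -/
def bgen {g n : ℕ} [NeZero (n - 1)] (x : Gen g n) : SurfaceBraidGroup g n :=
  PresentedGroup.of x

namespace Heis

variable {M : Type*} [AddCommGroup M] {s : SF M}

lemma mk_zero_zpow (k : ℤ) : (⟨1, 0⟩ : Heis s) ^ k = ⟨k, 0⟩ := by
  induction k using Int.induction_on with
  | zero => rfl
  | succ i ih => rw [zpow_add_one, ih, mul_def]; simp [omega_zero_left]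
  | pred i ih => rw [zpow_sub_one, ih, inv_def, mul_def]; simp [omega_zero_left, sub_eq_add_neg]

/-- A subgroup of the Heisenberg group that contains the generator `(1, 0)` of the centre and
a lift of each element of a generating set of `M` is the whole group. -/
lemma subgroup_eq_top (H : Subgroup (Heis s)) (hc : (⟨1, 0⟩ : Heis s) ∈ H) (T : Set M)
    (hT : AddSubgroup.closure T = ⊤) (hH : ∀ v ∈ T, ∃ k, (⟨k, v⟩ : Heis s) ∈ H) : H = ⊤ := by
  have lift (x : M) : ∃ k, (⟨k, x⟩ : Heis s) ∈ H := by
    have hx : x ∈ AddSubgroup.closure T := hT ▸ AddSubgroup.mem_top x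
    induction hx using AddSubgroup.closure_induction with
    | mem v hv => exact hH v hv
    | zero => exact ⟨0, H.one_mem⟩
    | add x y _ _ hx hy =>
      obtain ⟨k, hk⟩ := hx
      obtain ⟨l, hl⟩ := hy
      exact ⟨_, H.mul_mem hk hl⟩
    | neg x _ hx =>
      obtain ⟨k, hk⟩ := hx
      exact ⟨_, H.inv_mem hk⟩
  refine (Subgroup.eq_top_iff' H).2 fun ⟨k, x⟩ => ?_
  obtain ⟨l, hl⟩ := lift x
  have h := H.mul_mem (H.zpow_mem hc (k - l)) hl
  rw [mk_zero_zpow, mul_def] at h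
  simpa [omega_zero_left] using h

/-- Elements over `0 : M` are central. -/
lemma mk_zero_comm (k : ℤ) (y : Heis s) : (⟨k, 0⟩ : Heis s) * y = y * ⟨k, 0⟩ := by
  simp [mul_def, omega_zero_left, omega_zero_right, add_comm]

lemma mul_comm_of_omega_eq_zero {x y : Heis s} (h : s.ω x.x y.x = 0) (h' : s.ω y.x x.x = 0) :
    x * y = y * x := by
  simp [mul_def, h, h', add_comm]

end Heis

/-- The standard basis vectors `a_r` (`inl r`) and `b_s` (`inr s`) of `ℤ^{2g}`. -/
def stdVec (g : ℕ) : Fin g ⊕ Fin g → (Fin g → ℤ) × (Fin g → ℤ)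
  | .inl r => (Pi.single r 1, 0)
  | .inr s => (0, Pi.single s 1)

lemma closure_range_stdVec (g : ℕ) : AddSubgroup.closure (Set.range (stdVec g)) = ⊤ := by
  refine (AddSubgroup.eq_top_iff' _).2 fun ⟨x, y⟩ => ?_
  have h : (x, y) = ∑ i, x i • stdVec g (.inl i) + ∑ i, y i • stdVec g (.inr i) := by
    ext j <;>
      simp [stdVec, Prod.fst_sum, Prod.snd_sum, Finset.sum_apply, Pi.single_apply]
  rw [h]
  exact add_mem
    (sum_mem fun i _ => zsmul_mem (AddSubgroup.subset_closure (Set.mem_range_self _)) _)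
    (sum_mem fun i _ => zsmul_mem (AddSubgroup.subset_closure (Set.mem_range_self _)) _)

lemma stdSF_stdVec_eq_zero {g : ℕ} {z w : Fin g ⊕ Fin g}
    (hpair : ∀ r : Fin g, ¬(z = .inl r ∧ w = .inr r) ∧ ¬(z = .inr r ∧ w = .inl r)) :
    (stdSF g).ω (stdVec g z) (stdVec g w) = 0 := by
  rcases z with r | r <;> rcases w with t | t
  · simp [stdSF, stdVec]
  · have : r ≠ t := fun h => (hpair r).1 ⟨rfl, by rw [h]⟩
    simp [stdSF, stdVec, Pi.single_apply, this.symm]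
  · have : r ≠ t := fun h => (hpair r).2 ⟨rfl, by rw [h]⟩
    simp [stdSF, stdVec, Pi.single_apply, this.symm]
  · simp [stdSF, stdVec]

/-- The prescribed images of the generators in the Heisenberg group. -/
def genHeis {g n : ℕ} : Gen g n → Heis (stdSF g)
  | .sig _ => ⟨1, 0⟩
  | .a r => ⟨0, stdVec g (.inl r)⟩
  | .b r => ⟨0, stdVec g (.inr r)⟩

lemma lift_genHeis_gsig {g n : ℕ} (i : Fin (n - 1)) :
    FreeGroup.lift (genHeis (g := g)) (gsig i) = ⟨1, 0⟩ := by
  simp [gsig, genHeis]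

lemma lift_genHeis_gab {g n : ℕ} (z : Fin g ⊕ Fin g) :
    FreeGroup.lift (genHeis (n := n)) (gab z) = ⟨0, stdVec g z⟩ := by
  cases z <;> simp [gab, genHeis]

lemma lift_genHeis_eq_one {g n : ℕ} [NeZero (n - 1)] {x : FreeGroup (Gen g n)}
    (hx : IsRel g n x) : FreeGroup.lift genHeis x = 1 := by
  have comm_eq_one {x y : Heis (stdSF g)} (h : x * y = y * x) : x * y * x⁻¹ * y⁻¹ = 1 := by
    rw [h, mul_inv_cancel_right, mul_inv_cancel]
  cases hx with
  | comm_far i j h =>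
    simp only [map_mul, map_inv, lift_genHeis_gsig]
    exact comm_eq_one rfl
  | braid i j h =>
    simp only [map_mul, map_inv, lift_genHeis_gsig, mul_inv_cancel]
  | comm_sig i h z =>
    simp only [map_mul, map_inv, lift_genHeis_gsig, lift_genHeis_gab]
    exact comm_eq_one (Heis.mk_zero_comm _ _).symm
  | comm_conj1 z =>
    simp only [map_mul, map_inv, lift_genHeis_gsig, lift_genHeis_gab]
    refine comm_eq_one (Heis.mul_comm_of_omega_eq_zero ?_ ?_) <;>
      simp [Heis.mul_def, (stdSF g).alt]
  | comm_conj2 z w hne hpair =>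
    simp only [map_mul, map_inv, lift_genHeis_gsig, lift_genHeis_gab]
    refine comm_eq_one (Heis.mul_comm_of_omega_eq_zero ?_ ?_)
    · simpa [Heis.mul_def, Heis.inv_def] using stdSF_stdVec_eq_zero hpair
    · simpa [Heis.mul_def, Heis.inv_def] using
        stdSF_stdVec_eq_zero fun r => ⟨fun h => (hpair r).2 h.symm, fun h => (hpair r).1 h.symm⟩
  | special r =>
    simp only [map_mul, map_inv, lift_genHeis_gsig, lift_genHeis_gab]
    rw [mul_inv_eq_one]
    simp only [Heis.mul_def, Heis.mk.injEq]
    simp [stdSF, stdVec, Pi.single_apply, add_comm]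

/-- there is a unique group homomorphism φ : B_n(Σ) → H_g with
φ(σ_i) = (1,0) for all i, φ(α_r) = (0,a_r) and φ(β_s) = (0,b_s) for all r,s;
moreover φ is surjective. -/
theorem stmt_0 (g n : ℕ) [NeZero (n - 1)] (hg : 1 ≤ g) (hn : 2 ≤ n) :
    (∃! φ : SurfaceBraidGroup g n →* Heis (stdSF g),
      (∀ i : Fin (n - 1), φ (bgen (Gen.sig i)) = ⟨1, 0⟩) ∧
      (∀ r : Fin g, φ (bgen (Gen.a r)) = ⟨0, (Pi.single r 1, 0)⟩) ∧
      (∀ s : Fin g, φ (bgen (Gen.b s)) = ⟨0, (0, Pi.single s 1)⟩)) ∧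
    (∀ φ : SurfaceBraidGroup g n →* Heis (stdSF g),
      ((∀ i : Fin (n - 1), φ (bgen (Gen.sig i)) = ⟨1, 0⟩) ∧
       (∀ r : Fin g, φ (bgen (Gen.a r)) = ⟨0, (Pi.single r 1, 0)⟩) ∧
       (∀ s : Fin g, φ (bgen (Gen.b s)) = ⟨0, (0, Pi.single s 1)⟩)) →
      Function.Surjective φ) := by
  refine ⟨⟨PresentedGroup.toGroup (f := genHeis) fun _ hx => lift_genHeis_eq_one hx,
    ⟨fun _ => PresentedGroup.toGroup.of _, fun _ => PresentedGroup.toGroup.of _,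
      fun _ => PresentedGroup.toGroup.of _⟩, ?_⟩, ?_⟩
  · rintro ψ ⟨hs, ha, hb⟩
    refine PresentedGroup.ext fun x => Eq.trans ?_ (PresentedGroup.toGroup.of _).symm
    cases x with
    | sig i => exact hs i
    | a r => exact ha r
    | b r => exact hb r
  · rintro φ ⟨hs, ha, hb⟩
    refine MonoidHom.range_eq_top.1
      (Heis.subgroup_eq_top _ ⟨_, hs 0⟩ _ (closure_range_stdVec g) ?_)
    rintro _ ⟨r | r, rfl⟩
    · exact ⟨0, _, ha r⟩
    · exact ⟨0, _, hb r⟩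
end

section
/- In the algebra A ⊗_ℂ A one has R·R' = 1 ⊗ 1; that is, R is invertible with inverse R'. -/
open scoped TensorProduct

/-- The group algebra A = ℂ[K]/(K^p − 1) of the cyclic group ℤ/pℤ, written
multiplicatively. -/
abbrev CycAlg (p : ℕ) : Type := MonoidAlgebra ℂ (Multiplicative (ZMod p))

/-- The generator K of the group algebra, as a unit. -/
noncomputable def KU (p : ℕ) : (CycAlg p)ˣ :=
  Units.map (MonoidAlgebra.of ℂ (Multiplicative (ZMod p)))
    (toUnits (Multiplicative.ofAdd (1 : ZMod p)))

section CyclicFourier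

variable {F A : Type*} [Field F] [CommRing A] [Algebra F A] {p : ℕ} {q : F}

theorem IsPrimitiveRoot.sum_zpow_mul_eq_ite (hq : IsPrimitiveRoot q p) (a : ℤ) :
    ∑ k ∈ Finset.range p, q ^ (a * (k : ℤ)) = if (p : ℤ) ∣ a then (p : F) else 0 := by
  simp only [zpow_mul, zpow_natCast]
  split_ifs with h
  · simp [(hq.zpow_eq_one_iff_dvd a).2 h]
  · have h1 : q ^ a ≠ 1 := fun h' => h ((hq.zpow_eq_one_iff_dvd a).1 h')
    have h2 : (q ^ a) ^ p = 1 := by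
      rw [← zpow_natCast, ← zpow_mul, mul_comm, zpow_mul, zpow_natCast, hq.pow_eq_one, one_zpow]
    rw [geom_sum_eq h1, h2, sub_self, zero_div]

/-- The `p`-th multiple of the idempotent projecting onto the `q ^ j`-eigenspace of a unit `u`
with `u ^ p = 1`. -/
def fourierSum (p : ℕ) (q : F) (u : Aˣ) (j : ℕ) : A :=
  ∑ i ∈ Finset.range p, q ^ (-((i : ℤ) * (j : ℤ))) • ((u ^ i : Aˣ) : A)

theorem mul_fourierSum (hq : IsPrimitiveRoot q p) (hp : 0 < p) {u : Aˣ} (hu : u ^ p = 1) (j : ℕ) :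
    (u : A) * fourierSum p q u j = q ^ j • fourierSum p q u j := by
  have hq0 : q ≠ 0 := hq.ne_zero hp.ne'
  set f : ℕ → A := fun i => q ^ (-((i : ℤ) * (j : ℤ))) • ((u ^ i : Aˣ) : A) with hf
  have hstep (i : ℕ) : (u : A) * f i = q ^ j • f (i + 1) := by
    simp only [hf, mul_smul_comm, smul_smul, ← Units.val_mul, ← pow_succ']
    congr 1
    rw [← zpow_natCast q j, ← zpow_add₀ hq0]
    congr 1
    push_cast
    ring
  have hwrap : f p = f 0 := by
    simp only [hf, hu]
    simp [zpow_mul, hq.pow_eq_one]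
  have hshift : ∑ i ∈ Finset.range p, f (i + 1) = ∑ i ∈ Finset.range p, f i := by
    have h := (Finset.sum_range_succ' f p).symm.trans (Finset.sum_range_succ f p)
    rw [hwrap] at h
    exact add_right_cancel h
  change (u : A) * ∑ i ∈ Finset.range p, f i = q ^ j • ∑ i ∈ Finset.range p, f i
  rw [Finset.mul_sum, Finset.sum_congr rfl fun i _ => hstep i, ← Finset.smul_sum, hshift]

theorem inv_pow_mul_fourierSum (hq : IsPrimitiveRoot q p) (hp : 0 < p) {u : Aˣ} (hu : u ^ p = 1)
    (j k : ℕ) :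
    ((u⁻¹ ^ k : Aˣ) : A) * fourierSum p q u j =
      q ^ (-((j : ℤ) * (k : ℤ))) • fourierSum p q u j := by
  have hq0 : q ≠ 0 := hq.ne_zero hp.ne'
  have hinv : ((u⁻¹ : Aˣ) : A) * fourierSum p q u j = (q ^ j)⁻¹ • fourierSum p q u j := by
    rw [Units.inv_mul_eq_iff_eq_mul, mul_smul_comm, mul_fourierSum hq hp hu, smul_smul,
      inv_mul_cancel₀ (pow_ne_zero j hq0), one_smul]
  induction k with
  | zero => simp
  | succ k ih =>
    rw [pow_succ, Units.val_mul, mul_assoc, hinv, mul_smul_comm, ih, smul_smul,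
      ← zpow_natCast q j, ← zpow_neg, ← zpow_add₀ hq0]
    congr 2
    push_cast
    ring

theorem fourierSum_mul_inv_sum (hq : IsPrimitiveRoot q p) (hp : 0 < p) {u : Aˣ} (hu : u ^ p = 1)
    {j l : ℕ} (hj : j < p) (hl : l < p) :
    fourierSum p q u j *
        ∑ k ∈ Finset.range p, q ^ ((k : ℤ) * (l : ℤ)) • ((u⁻¹ ^ k : Aˣ) : A) =
      if l = j then (p : F) • fourierSum p q u j else 0 := by
  have hq0 : q ≠ 0 := hq.ne_zero hp.ne'
  have hterm (k : ℕ) : fourierSum p q u j * (q ^ ((k : ℤ) * (l : ℤ)) • ((u⁻¹ ^ k : Aˣ) : A)) =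
      q ^ (((l : ℤ) - j) * k) • fourierSum p q u j := by
    rw [mul_smul_comm, mul_comm (fourierSum p q u j), inv_pow_mul_fourierSum hq hp hu, smul_smul, ← zpow_add₀ hq0]
    congr 2
    ring
  have hdvd : (p : ℤ) ∣ (l : ℤ) - j ↔ l = j := by
    refine ⟨fun h => ?_, fun h => by simp [h]⟩
    have := Int.eq_zero_of_abs_lt_dvd h (by rw [abs_lt]; omega)
    omega
  rw [Finset.mul_sum, Finset.sum_congr rfl fun k _ => hterm k, ← Finset.sum_smul,
    hq.sum_zpow_mul_eq_ite]
  simp only [hdvd, ite_smul, zero_smul]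

theorem sum_fourierSum (hq : IsPrimitiveRoot q p) (hp : 0 < p) (u : Aˣ) :
    ∑ j ∈ Finset.range p, fourierSum p q u j = (p : F) • (1 : A) := by
  have hterm (i : ℕ) (hi : i ∈ Finset.range p) :
      ∑ j ∈ Finset.range p, q ^ (-((i : ℤ) * (j : ℤ))) • ((u ^ i : Aˣ) : A) =
        if i = 0 then (p : F) • (1 : A) else 0 := by
    have hdvd : (p : ℤ) ∣ -(i : ℤ) ↔ i = 0 := by
      rw [dvd_neg, Int.natCast_dvd_natCast]
      exact ⟨fun h => Nat.eq_zero_of_dvd_of_lt h (Finset.mem_range.1 hi), fun h => by simp [h]⟩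
    simp only [← neg_mul]
    rw [← Finset.sum_smul, hq.sum_zpow_mul_eq_ite]
    simp only [hdvd]
    split_ifs with h
    · simp [h]
    · simp
  simp only [fourierSum]
  rw [Finset.sum_comm, Finset.sum_congr rfl hterm]
  simp [hp]

/-- The two quantum Fourier kernels attached to units `u`, `v`, the first of order dividing `p`,
are inverse to each other up to the factor `p ^ 2`. -/
theorem fourierKernel_mul_inv {B : Type*} [CommRing B] [Algebra F B] (hq : IsPrimitiveRoot q p)
    (hp : 0 < p) {u : Aˣ} (hu : u ^ p = 1) (v : Bˣ) :
    (∑ i ∈ Finset.range p, ∑ j ∈ Finset.range p,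
        q ^ (-((i : ℤ) * (j : ℤ))) • ((u ^ i : Aˣ) : A) ⊗ₜ[F] ((v ^ j : Bˣ) : B)) *
      (∑ i ∈ Finset.range p, ∑ j ∈ Finset.range p,
        q ^ ((i : ℤ) * (j : ℤ)) • ((u⁻¹ ^ i : Aˣ) : A) ⊗ₜ[F] ((v⁻¹ ^ j : Bˣ) : B)) =
      ((p : F) * p) • 1 := by
  have hleft : (∑ i ∈ Finset.range p, ∑ j ∈ Finset.range p,
        q ^ (-((i : ℤ) * (j : ℤ))) • ((u ^ i : Aˣ) : A) ⊗ₜ[F] ((v ^ j : Bˣ) : B)) =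
      ∑ j ∈ Finset.range p, fourierSum p q u j ⊗ₜ[F] ((v ^ j : Bˣ) : B) := by
    rw [Finset.sum_comm]
    simp only [fourierSum, TensorProduct.sum_tmul, TensorProduct.smul_tmul']
  have hright : (∑ i ∈ Finset.range p, ∑ j ∈ Finset.range p,
        q ^ ((i : ℤ) * (j : ℤ)) • ((u⁻¹ ^ i : Aˣ) : A) ⊗ₜ[F] ((v⁻¹ ^ j : Bˣ) : B)) =
      ∑ l ∈ Finset.range p,
        (∑ k ∈ Finset.range p, q ^ ((k : ℤ) * (l : ℤ)) • ((u⁻¹ ^ k : Aˣ) : A)) ⊗ₜ[F]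
          ((v⁻¹ ^ l : Bˣ) : B) := by
    rw [Finset.sum_comm]
    simp only [TensorProduct.sum_tmul, TensorProduct.smul_tmul']
  have hterm (j : ℕ) (hj : j ∈ Finset.range p) :
      ∑ l ∈ Finset.range p, (fourierSum p q u j ⊗ₜ[F] ((v ^ j : Bˣ) : B)) *
        ((∑ k ∈ Finset.range p, q ^ ((k : ℤ) * (l : ℤ)) • ((u⁻¹ ^ k : Aˣ) : A)) ⊗ₜ[F]
          ((v⁻¹ ^ l : Bˣ) : B)) = (p : F) • fourierSum p q u j ⊗ₜ[F] (1 : B) := by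
    rw [Finset.sum_eq_single_of_mem j hj]
    · rw [Algebra.TensorProduct.tmul_mul_tmul,
        fourierSum_mul_inv_sum hq hp hu (Finset.mem_range.1 hj) (Finset.mem_range.1 hj),
        if_pos rfl, ← Units.val_mul, inv_pow, mul_inv_cancel, Units.val_one,
        TensorProduct.smul_tmul']
    · intro l hl hlj
      rw [Algebra.TensorProduct.tmul_mul_tmul,
        fourierSum_mul_inv_sum hq hp hu (Finset.mem_range.1 hj) (Finset.mem_range.1 hl),
        if_neg hlj, TensorProduct.zero_tmul]
  rw [hleft, hright, Finset.sum_mul_sum, Finset.sum_congr rfl hterm, ← Finset.smul_sum,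
    ← TensorProduct.sum_tmul, sum_fourierSum hq hp, ← TensorProduct.smul_tmul', smul_smul,
    Algebra.TensorProduct.one_def]

end CyclicFourier

theorem KU_pow_card (p : ℕ) : KU p ^ p = 1 := by
  have h : (Multiplicative.ofAdd (1 : ZMod p)) ^ p = 1 := by
    rw [← ofAdd_nsmul]
    simp
  rw [KU, ← map_pow, ← map_pow, h, map_one, map_one]

/-- STATEMENT 13: in A ⊗ A one has R·R' = 1 ⊗ 1, i.e. R is invertible with
inverse R', where R = (1/p)Σ q^{−ij} K^i ⊗ K^j and
R' = (1/p)Σ q^{ij} K^{−i} ⊗ K^{−j}. -/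
theorem stmt_13 (p : ℕ) (hp : 3 ≤ p) (q : ℂ) (hq : IsPrimitiveRoot q p) :
    ((1 / (p : ℂ)) • ∑ i ∈ Finset.range p, ∑ j ∈ Finset.range p,
        q ^ (-((i : ℤ) * (j : ℤ))) • ((KU p ^ i : (CycAlg p)ˣ) : CycAlg p) ⊗ₜ[ℂ]
          ((KU p ^ j : (CycAlg p)ˣ) : CycAlg p)) *
      ((1 / (p : ℂ)) • ∑ i ∈ Finset.range p, ∑ j ∈ Finset.range p,
        q ^ ((i : ℤ) * (j : ℤ)) • (((KU p)⁻¹ ^ i : (CycAlg p)ˣ) : CycAlg p) ⊗ₜ[ℂ]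
          (((KU p)⁻¹ ^ j : (CycAlg p)ˣ) : CycAlg p)) = 1 := by
  have hp0 : (p : ℂ) ≠ 0 := Nat.cast_ne_zero.2 (by omega)
  rw [smul_mul_smul_comm, fourierKernel_mul_inv hq (by omega) (KU_pow_card p), smul_smul]
  field_simp
  exact one_smul _ _
end
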